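/- If in addition m is γ-Hölder continuous for some γ ∈ (0, 1], i.e. |m_t − m_s| ≤ Λ|t − s|^γ for all s, t ∈ [0, T], then there exists a constant K (depending only on σ, b, T, m, Λ, γ and x₀) such that sup_{t ∈ [0, T]} |X^ε_t − X̄_t| ≤ K ε^{γ/(1+γ)} for all ε ∈ (0, 1]. -/

import Mathlib

open intervalIntegral

/-- `Y : ℝ → ℝ` is a continuous solution on `[0, T]` of the (Doss–Sussmann transformed)
integral equation
`Y t = H (0, x₀) + ∫₀^t (∂H/∂x) (m s, F (m s, Y s)) · b (F (m s, Y s), s / ε) ds`. -/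
def SolvesAveragingODE (F H : ℝ × ℝ → ℝ) (b : ℝ × ℝ → ℝ) (m : ℝ → ℝ)
    (T x₀ ε : ℝ) (Y : ℝ → ℝ) : Prop :=
  ContinuousOn Y (Set.Icc 0 T) ∧
  ∀ t ∈ Set.Icc (0:ℝ) T,
    Y t = H (0, x₀) + ∫ s in (0:ℝ)..t,
      deriv (fun y : ℝ => H (m s, y)) (F (m s, Y s)) * b (F (m s, Y s), s / ε)

theorem abs_image_sub_le_of_abs_deriv_le {f : ℝ → ℝ} {C : ℝ} (hf : Differentiable ℝ f)
    (hC : ∀ x, |deriv f x| ≤ C) (x y : ℝ) : |f x - f y| ≤ C * |x - y| :=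
  convex_univ.norm_image_sub_le_of_norm_deriv_le (fun z _ => hf z) (fun z _ => hC z)
    (Set.mem_univ y) (Set.mem_univ x)

/-- First order Taylor expansion with a quadratic remainder. -/
theorem abs_sub_sub_deriv_mul_le {f : ℝ → ℝ} {C : ℝ} (hf : ContDiff ℝ 2 f)
    (hC : ∀ x, |deriv (deriv f) x| ≤ C) (x y : ℝ) :
    |f x - f y - deriv f y * (x - y)| ≤ C * |x - y| ^ 2 := by
  have hC0 : 0 ≤ C := (abs_nonneg _).trans (hC 0)
  have hd : Differentiable ℝ f := hf.differentiable (by norm_num)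
  have hd' : Differentiable ℝ (deriv f) :=
    ((contDiff_succ_iff_deriv (n := 1)).1 hf).2.2.differentiable (by norm_num)
  have key := (convex_uIcc y x).norm_image_sub_le_of_norm_hasDerivWithin_le
    (f := fun z => f z - deriv f y * z) (f' := fun z => deriv f z - deriv f y)
    (C := C * |x - y|) (x := y) (y := x)
    (fun z _ => (((hd z).hasDerivAt).sub
      (by simpa using (hasDerivAt_id z).const_mul (deriv f y))).hasDerivWithinAt)
    (fun z hz => (abs_image_sub_le_of_abs_deriv_le hd' hC z y).trans
      (mul_le_mul_of_nonneg_left (Set.abs_sub_left_of_mem_uIcc hz) hC0))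
    Set.left_mem_uIcc Set.right_mem_uIcc
  simp only [Real.norm_eq_abs] at key
  calc |f x - f y - deriv f y * (x - y)|
      = |f x - deriv f y * x - (f y - deriv f y * y)| := by ring_nf
    _ ≤ _ := key
    _ = C * |x - y| ^ 2 := by ring

/-- Two trajectories of an autonomous Lipschitz equation separate, forwards and backwards in time,
at most exponentially fast. -/
theorem abs_trajectory_sub_le {σ f g : ℝ → ℝ} {C : ℝ} (hσ : ∀ x y, |σ x - σ y| ≤ C * |x - y|)
    (hf : ∀ r, HasDerivAt f (σ (f r)) r) (hg : ∀ r, HasDerivAt g (σ (g r)) r) (r s : ℝ) :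
    |f r - g r| ≤ Real.exp (C * |r - s|) * |f s - g s| := by
  have hprod : ∀ u, |(f u - g u) * (σ (f u) - σ (g u))| ≤ C * (f u - g u) ^ 2 := fun u => by
    rw [abs_mul, ← sq_abs (f u - g u)]
    nlinarith [mul_le_mul_of_nonneg_left (hσ (f u) (g u)) (abs_nonneg (f u - g u))]
  have hder : ∀ k u, HasDerivAt (fun u => (f u - g u) ^ 2 * Real.exp (k * u))
      ((2 * ((f u - g u) * (σ (f u) - σ (g u))) + k * (f u - g u) ^ 2) * Real.exp (k * u)) u := by
    intro k u
    refine ((((hf u).sub (hg u)).pow 2).mul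
      (((hasDerivAt_id u).const_mul k).exp)).congr_deriv ?_
    simp
    ring
  have hsq : (f r - g r) ^ 2 ≤ (Real.exp (C * |r - s|) * (f s - g s)) ^ 2 := by
    rcases le_total s r with h | h
    · have hanti : Antitone (fun u => (f u - g u) ^ 2 * Real.exp (-(2 * C) * u)) :=
        antitone_of_deriv_nonpos (fun u => (hder _ u).differentiableAt) fun u => by
          rw [(hder _ u).deriv]
          exact mul_nonpos_of_nonpos_of_nonneg
            (by linarith [(abs_le.1 (hprod u)).2]) (Real.exp_pos _).le
      have := mul_le_mul_of_nonneg_right (hanti h) (Real.exp_pos (2 * C * r)).le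
      simp only [mul_assoc, ← Real.exp_add] at this
      rw [abs_of_nonneg (sub_nonneg.2 h), mul_pow, ← Real.exp_nat_mul]
      ring_nf at this ⊢
      simpa using this
    · have hmono : Monotone (fun u => (f u - g u) ^ 2 * Real.exp ((2 * C) * u)) :=
        monotone_of_deriv_nonneg (fun u => (hder _ u).differentiableAt) fun u => by
          rw [(hder _ u).deriv]
          exact mul_nonneg
            (by linarith [(abs_le.1 (hprod u)).1]) (Real.exp_pos _).le
      have := mul_le_mul_of_nonneg_right (hmono h) (Real.exp_pos (-(2 * C * r))).le
      simp only [mul_assoc, ← Real.exp_add] at this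
      rw [abs_of_nonpos (sub_nonpos.2 h), mul_pow, ← Real.exp_nat_mul]
      ring_nf at this ⊢
      simpa using this
  have := sq_le_sq.1 hsq
  rwa [abs_mul, abs_of_pos (Real.exp_pos _)] at this

/-- The flow of `σ` is differentiable in its initial value. -/
theorem hasDerivAt_flow {σ : ℝ → ℝ} (hσ : ContDiff ℝ 2 σ)
    {C₁ : ℝ} (hC₁ : ∀ x, |deriv σ x| ≤ C₁)
    {C₂ : ℝ} (hC₂ : ∀ x, |deriv (deriv σ) x| ≤ C₂)
    {F : ℝ × ℝ → ℝ} (hF0 : ∀ x : ℝ, F (0, x) = x)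
    (hFr : ∀ r x : ℝ, HasDerivAt (fun r' : ℝ => F (r', x)) (σ (F (r, x))) r) (r y : ℝ) :
    HasDerivAt (fun x => F (r, x)) (Real.exp (∫ u in (0:ℝ)..r, deriv σ (F (u, y)))) y := by
  have hC₁0 : 0 ≤ C₁ := (abs_nonneg _).trans (hC₁ 0)
  have hC₂0 : 0 ≤ C₂ := (abs_nonneg _).trans (hC₂ 0)
  have hLip := abs_image_sub_le_of_abs_deriv_le (hσ.differentiable (by norm_num)) hC₁
  have hcont : Continuous fun u => deriv σ (F (u, y)) :=
    (hσ.continuous_deriv (by norm_num)).comp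
      (continuous_iff_continuousAt.2 fun u => (hFr u y).continuousAt)
  set P : ℝ → ℝ := fun v => ∫ u in (0:ℝ)..v, deriv σ (F (u, y)) with hPdef
  have hP : ∀ v, HasDerivAt P (deriv σ (F (v, y))) v := fun v =>
    (hcont.integral_hasStrictDerivAt 0 v).hasDerivAt
  have hPle : ∀ v, |P v| ≤ C₁ * |v| := fun v => by
    simpa using intervalIntegral.norm_integral_le_of_norm_le_const
      (a := 0) (b := v) (f := fun u => deriv σ (F (u, y))) (fun u _ => hC₁ _)
  set Q : ℝ := C₂ * (Real.exp (C₁ * |r|)) ^ 3 * |r|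
  have hrem : ∀ x, |F (r, x) - F (r, y) - Real.exp (P r) * (x - y)|
      ≤ Real.exp (P r) * Q * (x - y) ^ 2 := by
    intro x
    have hW : ∀ v, HasDerivAt (fun v => (F (v, x) - F (v, y)) * Real.exp (-P v))
        ((σ (F (v, x)) - σ (F (v, y)) - deriv σ (F (v, y)) * (F (v, x) - F (v, y)))
          * Real.exp (-P v)) v := fun v => by
      refine (((hFr v x).sub (hFr v y)).mul ((hP v).neg.exp)).congr_deriv ?_
      simp
      ring
    have hb : ∀ v ∈ Set.uIcc 0 r,
        ‖(σ (F (v, x)) - σ (F (v, y)) - deriv σ (F (v, y)) * (F (v, x) - F (v, y)))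
          * Real.exp (-P v)‖ ≤ C₂ * (Real.exp (C₁ * |r|)) ^ 3 * (x - y) ^ 2 := by
      intro v hv
      have hvr : |v| ≤ |r| := by simpa using Set.abs_sub_left_of_mem_uIcc hv
      have hCv : C₁ * |v| ≤ C₁ * |r| := mul_le_mul_of_nonneg_left hvr hC₁0
      have h1 : |F (v, x) - F (v, y)| ≤ Real.exp (C₁ * |r|) * |x - y| := by
        have := abs_trajectory_sub_le hLip (hFr · x) (hFr · y) v 0
        simp only [hF0, sub_zero] at this
        exact this.trans (by gcongr)
      have h2 : Real.exp (-P v) ≤ Real.exp (C₁ * |r|) :=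
        Real.exp_le_exp.2 (by linarith [neg_abs_le (P v), hPle v])
      have h3 := abs_sub_sub_deriv_mul_le hσ hC₂ (F (v, x)) (F (v, y))
      rw [Real.norm_eq_abs, abs_mul, abs_of_pos (Real.exp_pos _)]
      calc _ ≤ (C₂ * (Real.exp (C₁ * |r|) * |x - y|) ^ 2) * Real.exp (C₁ * |r|) := by
            refine mul_le_mul (h3.trans ?_) h2 (Real.exp_pos _).le (by positivity)
            gcongr
        _ = _ := by rw [mul_pow, sq_abs]; ring
    have key := (convex_uIcc 0 r).norm_image_sub_le_of_norm_hasDerivWithin_le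
      (fun v _ => (hW v).hasDerivWithinAt) hb Set.left_mem_uIcc Set.right_mem_uIcc
    have hP0 : P 0 = 0 := by simp [hPdef]
    simp only [hF0, hP0, neg_zero, Real.exp_zero, mul_one, sub_zero, Real.norm_eq_abs] at key
    have he : F (r, x) - F (r, y) - Real.exp (P r) * (x - y)
        = Real.exp (P r) * ((F (r, x) - F (r, y)) * Real.exp (-P r) - (x - y)) := by
      rw [Real.exp_neg]
      field_simp
    rw [he, abs_mul, abs_of_pos (Real.exp_pos _), mul_assoc]
    refine mul_le_mul_of_nonneg_left (key.trans_eq ?_) (Real.exp_pos _).le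
    ring
  have hO : (fun x => F (r, x) - F (r, y) - Real.exp (P r) * (x - y))
      =O[nhds y] fun x => ‖x - y‖ ^ 2 :=
    Asymptotics.IsBigO.of_bound (Real.exp (P r) * Q) <| Filter.Eventually.of_forall fun x => by
      simpa using hrem x
  have h0 := (hO.hasFDerivAt (by norm_num)).hasDerivAt
  have h1 : HasDerivAt (fun x => F (r, y) + Real.exp (P r) * (x - y)) (Real.exp (P r)) y := by
    simpa using (((hasDerivAt_id y).sub_const y).const_mul (Real.exp (P r))).const_add (F (r, y))
  have h2 := h0.add h1
  simp only [zero_apply, zero_add] at h2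
  refine h2.congr_of_eventuallyEq (Filter.Eventually.of_forall fun x => ?_)
  simp

theorem deriv_inverse_flow {σ : ℝ → ℝ} (hσ : ContDiff ℝ 2 σ)
    {C₁ : ℝ} (hC₁ : ∀ x, |deriv σ x| ≤ C₁)
    {C₂ : ℝ} (hC₂ : ∀ x, |deriv (deriv σ) x| ≤ C₂)
    {F H : ℝ × ℝ → ℝ} (hF0 : ∀ x : ℝ, F (0, x) = x)
    (hFr : ∀ r x : ℝ, HasDerivAt (fun r' : ℝ => F (r', x)) (σ (F (r, x))) r)
    (hH : ∀ r : ℝ, Function.LeftInverse (fun y : ℝ => H (r, y)) (fun x : ℝ => F (r, x)) ∧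
      Function.RightInverse (fun y : ℝ => H (r, y)) (fun x : ℝ => F (r, x))) (r y : ℝ) :
    deriv (fun z : ℝ => H (r, z)) (F (r, y))
      = Real.exp (-∫ u in (0:ℝ)..r, deriv σ (F (u, y))) := by
  have hLip := abs_image_sub_le_of_abs_deriv_le (hσ.differentiable (by norm_num)) hC₁
  have hHL : ∀ z w, |H (r, z) - H (r, w)| ≤ Real.exp (C₁ * |r|) * |z - w| := fun z w => by
    have := abs_trajectory_sub_le hLip (hFr · (H (r, z))) (hFr · (H (r, w))) 0 r
    have hz : F (r, H (r, z)) = z := (hH r).2 z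
    have hw : F (r, H (r, w)) = w := (hH r).2 w
    simpa only [hF0, hz, hw, zero_sub, abs_neg] using this
  have hcont : Continuous fun z => H (r, z) :=
    (LipschitzWith.of_dist_le_mul (K := ⟨Real.exp (C₁ * |r|), (Real.exp_pos _).le⟩)
      fun z w => hHL z w).continuous
  have hy : H (r, F (r, y)) = y := (hH r).1 y
  have hd := hasDerivAt_flow hσ hC₁ hC₂ hF0 hFr r y
  rw [Real.exp_neg]
  refine (HasDerivAt.of_local_left_inverse (f := fun x => F (r, x)) hcont.continuousAt ?_
    (Real.exp_ne_zero _) (Filter.Eventually.of_forall fun z => (hH r).2 z)).deriv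
  simpa only [hy] using hd

theorem abs_exp_sub_exp_le {u v C : ℝ} (hu : |u| ≤ C) (hv : |v| ≤ C) :
    |Real.exp u - Real.exp v| ≤ Real.exp C * |u - v| :=
  (convex_Icc (-C) C).norm_image_sub_le_of_norm_deriv_le (f := Real.exp)
    (fun _ _ => Real.differentiableAt_exp)
    (fun z hz => by
      rw [Real.deriv_exp, Real.norm_eq_abs, abs_of_pos (Real.exp_pos z)]
      exact Real.exp_le_exp.2 hz.2)
    (abs_le.1 hv) (abs_le.1 hu)

/-- The flow and the reciprocal of its spatial derivative are bounded and Lipschitz on compact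
sets. -/
theorem exists_flow_local_bounds {σ : ℝ → ℝ} (hσ : ContDiff ℝ 2 σ)
    {C₁ : ℝ} (hC₁ : ∀ x, |deriv σ x| ≤ C₁)
    {C₂ : ℝ} (hC₂ : ∀ x, |deriv (deriv σ) x| ≤ C₂)
    {F : ℝ × ℝ → ℝ} (hF0 : ∀ x : ℝ, F (0, x) = x)
    (hFr : ∀ r x : ℝ, HasDerivAt (fun r' : ℝ => F (r', x)) (σ (F (r, x))) r)
    {a : ℝ → ℝ → ℝ} (ha : ∀ r y, a r y = Real.exp (-∫ u in (0:ℝ)..r, deriv σ (F (u, y))))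
    {R ρ : ℝ} (hR : 0 ≤ R) (hρ : 0 ≤ ρ) :
    ∃ c K : ℝ, 0 < c ∧ 0 ≤ K ∧
      (∀ r y, |r| ≤ R → |y| ≤ ρ → |F (r, y)| ≤ c) ∧
      ∀ r r' y y', |r| ≤ R → |r'| ≤ R → |y| ≤ ρ → |y'| ≤ ρ →
        |F (r, y) - F (r', y')| ≤ K * (|r - r'| + |y - y'|) ∧
        |a r y - a r' y'| ≤ K * (|r - r'| + |y - y'|) := by
  have hC₁0 : 0 ≤ C₁ := (abs_nonneg _).trans (hC₁ 0)
  have hC₂0 : 0 ≤ C₂ := (abs_nonneg _).trans (hC₂ 0)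
  have hLip := abs_image_sub_le_of_abs_deriv_le (hσ.differentiable (by norm_num)) hC₁
  have hLip' := abs_image_sub_le_of_abs_deriv_le
    (((contDiff_succ_iff_deriv (n := 1)).1 hσ).2.2.differentiable (by norm_num)) hC₂
  have hFc : ∀ y, Continuous fun u => F (u, y) := fun y =>
    continuous_iff_continuousAt.2 fun u => (hFr u y).continuousAt
  have hσF : ∀ y, Continuous fun u => deriv σ (F (u, y)) := fun y =>
    (hσ.continuous_deriv (by norm_num)).comp (hFc y)
  set E := Real.exp (C₁ * R)
  have hE : 0 < E := Real.exp_pos _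
  have hFy : ∀ r y y', |r| ≤ R → |F (r, y) - F (r, y')| ≤ E * |y - y'| := by
    intro r y y' hr
    have := abs_trajectory_sub_le hLip (hFr · y) (hFr · y') r 0
    simp only [hF0, sub_zero] at this
    refine this.trans ?_
    gcongr
    exact Real.exp_le_exp.2 (mul_le_mul_of_nonneg_left hr hC₁0)
  obtain ⟨c₀, hc₀⟩ := (isCompact_Icc (a := -R) (b := R)).exists_bound_of_continuousOn
    (hFc 0).continuousOn
  have hc₀0 : 0 ≤ c₀ := (norm_nonneg _).trans (hc₀ 0 ⟨by linarith, hR⟩)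
  have hFb : ∀ r y, |r| ≤ R → |y| ≤ ρ → |F (r, y)| ≤ E * ρ + c₀ + 1 := by
    intro r y hr hy
    have h1 := hFy r y 0 hr
    have h2 := hc₀ r (abs_le.1 hr)
    rw [sub_zero] at h1
    rw [Real.norm_eq_abs] at h2
    have h3 := abs_sub_abs_le_abs_sub (F (r, y)) (F (r, 0))
    nlinarith
  set c := E * ρ + c₀ + 1
  obtain ⟨S, hS⟩ := (isCompact_Icc (a := -c) (b := c)).exists_bound_of_continuousOn
    hσ.continuous.continuousOn
  have hS0 : 0 ≤ S := (norm_nonneg _).trans (hS 0 ⟨by simp only [c]; nlinarith, by positivity⟩)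
  have hFrr : ∀ r r' y, |r| ≤ R → |r'| ≤ R → |y| ≤ ρ → |F (r, y) - F (r', y)| ≤ S * |r - r'| :=
    fun r r' y hr hr' hy =>
      (convex_Icc (-R) R).norm_image_sub_le_of_norm_hasDerivWithin_le
        (f := fun u => F (u, y))
        (fun u _ => (hFr u y).hasDerivWithinAt)
        (fun u hu => hS _ (abs_le.1 (hFb u y (abs_le.2 hu) hy))) (abs_le.1 hr') (abs_le.1 hr)
  have hP : ∀ r y, |r| ≤ R → |-∫ u in (0:ℝ)..r, deriv σ (F (u, y))| ≤ C₁ * R := by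
    intro r y hr
    have := intervalIntegral.norm_integral_le_of_norm_le_const
      (a := 0) (b := r) (f := fun u => deriv σ (F (u, y))) (fun u _ => hC₁ _)
    rw [abs_neg]
    rw [sub_zero] at this
    exact this.trans (mul_le_mul_of_nonneg_left hr hC₁0)
  have hPr : ∀ r r' y, |(∫ u in (0:ℝ)..r, deriv σ (F (u, y))) -
      ∫ u in (0:ℝ)..r', deriv σ (F (u, y))| ≤ C₁ * |r - r'| := by
    intro r r' y
    rw [intervalIntegral.integral_interval_sub_left ((hσF y).intervalIntegrable _ _)
      ((hσF y).intervalIntegrable _ _)]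
    exact intervalIntegral.norm_integral_le_of_norm_le_const
      (f := fun u => deriv σ (F (u, y))) (fun u _ => hC₁ _)
  have hPy : ∀ r y y', |r| ≤ R → |(∫ u in (0:ℝ)..r, deriv σ (F (u, y))) -
      ∫ u in (0:ℝ)..r, deriv σ (F (u, y'))| ≤ C₂ * E * R * |y - y'| := by
    intro r y y' hr
    rw [← intervalIntegral.integral_sub ((hσF y).intervalIntegrable _ _)
      ((hσF y').intervalIntegrable _ _)]
    have := intervalIntegral.norm_integral_le_of_norm_le_const
      (a := 0) (b := r) (f := fun u => deriv σ (F (u, y)) - deriv σ (F (u, y')))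
      (C := C₂ * (E * |y - y'|)) (fun u hu => by
        have hur : |u| ≤ |r| := by
          simpa using Set.abs_sub_left_of_mem_uIcc (Set.uIoc_subset_uIcc hu)
        exact (hLip' _ _).trans
          (mul_le_mul_of_nonneg_left (hFy u y y' (hur.trans hr)) hC₂0))
    rw [sub_zero] at this
    calc _ ≤ C₂ * (E * |y - y'|) * |r| := this
      _ ≤ C₂ * (E * |y - y'|) * R := by gcongr
      _ = _ := by ring
  refine ⟨c, S + E + E * (C₁ + C₂ * E * R), by positivity, by positivity, hFb, ?_⟩
  intro r r' y y' hr hr' hy hy'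
  have hx : 0 ≤ |r - r'| := abs_nonneg _
  have hz : 0 ≤ |y - y'| := abs_nonneg _
  constructor
  · calc _ ≤ |F (r, y) - F (r', y)| + |F (r', y) - F (r', y')| := abs_sub_le _ _ _
      _ ≤ S * |r - r'| + E * |y - y'| := add_le_add (hFrr r r' y hr hr' hy) (hFy r' y y' hr')
      _ ≤ (S + E) * (|r - r'| + |y - y'|) := by nlinarith [mul_nonneg hS0 hz, mul_nonneg hE.le hx]
      _ ≤ _ := mul_le_mul_of_nonneg_right (le_add_of_nonneg_right (by positivity)) (by positivity)
  · rw [ha, ha]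
    have h1 := abs_exp_sub_exp_le (hP r y hr) (hP r' y' hr')
    have h2 := (abs_sub_le _ _ _).trans (add_le_add (hPr r r' y) (hPy r' y y' hr'))
    have h4 : 0 ≤ C₂ * E * R := by positivity
    calc _ ≤ E * _ := h1
      _ ≤ E * (C₁ * |r - r'| + C₂ * E * R * |y - y'|) := by
        rw [neg_sub_neg, abs_sub_comm]
        exact mul_le_mul_of_nonneg_left h2 hE.le
      _ ≤ E * ((C₁ + C₂ * E * R) * (|r - r'| + |y - y'|)) := by
        gcongr
        nlinarith [mul_nonneg hC₁0 hz, mul_nonneg h4 hx]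
      _ = E * (C₁ + C₂ * E * R) * (|r - r'| + |y - y'|) := by ring
      _ ≤ _ := mul_le_mul_of_nonneg_right (le_add_of_nonneg_left (by positivity)) (by positivity)

theorem continuousOn_of_abs_sub_le {f m Y : ℝ → ℝ} {s : Set ℝ} {K : ℝ}
    (hm : ContinuousOn m s) (hY : ContinuousOn Y s)
    (h : ∀ t ∈ s, ∀ u ∈ s, |f t - f u| ≤ K * (|m t - m u| + |Y t - Y u|)) :
    ContinuousOn f s := by
  intro u hu
  refine tendsto_iff_dist_tendsto_zero.2 (squeeze_zero' (Filter.Eventually.of_forall fun _ =>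
    dist_nonneg) (Filter.eventually_of_mem self_mem_nhdsWithin fun t ht => h t ht u hu) ?_)
  have h1 := tendsto_iff_dist_tendsto_zero.1 (hm u hu)
  have h2 := tendsto_iff_dist_tendsto_zero.1 (hY u hu)
  simpa [Real.dist_eq] using (h1.add h2).const_mul K

/-- Integral form of Grönwall's inequality. -/
theorem le_mul_exp_of_le_add_integral {D : ℝ → ℝ} {T η K : ℝ} (hK : 0 ≤ K)
    (hD : ContinuousOn D (Set.Icc 0 T))
    (h : ∀ t ∈ Set.Icc 0 T, D t ≤ η + K * ∫ s in (0:ℝ)..t, D s) :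
    ∀ t ∈ Set.Icc 0 T, D t ≤ η * Real.exp (K * t) := by
  intro t ht
  have hT : 0 ≤ T := ht.1.trans ht.2
  have hint : IntervalIntegrable D MeasureTheory.volume 0 T :=
    ContinuousOn.intervalIntegrable (by rwa [Set.uIcc_of_le hT])
  have hder : ∀ s ∈ Set.Ioo 0 T,
      HasDerivAt (fun s => (η + K * ∫ u in (0:ℝ)..s, D u) * Real.exp (-K * s))
        ((K * D s - K * (η + K * ∫ u in (0:ℝ)..s, D u)) * Real.exp (-K * s)) s := by
    intro s hs
    have hI : HasDerivAt (fun s => ∫ u in (0:ℝ)..s, D u) (D s) s :=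
      intervalIntegral.integral_hasDerivAt_right
        (hint.mono_set (by
          rw [Set.uIcc_of_le hT, Set.uIcc_of_le hs.1.le]
          exact Set.Icc_subset_Icc_right hs.2.le))
        ((hD.mono Set.Ioo_subset_Icc_self).stronglyMeasurableAtFilter isOpen_Ioo s hs)
        (hD.continuousAt (Icc_mem_nhds hs.1 hs.2))
    refine (((hI.const_mul K).const_add η).mul
      (((hasDerivAt_id s).const_mul (-K)).exp)).congr_deriv ?_
    simp
    ring
  have hcont : ContinuousOn (fun s => (η + K * ∫ u in (0:ℝ)..s, D u) * Real.exp (-K * s))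
      (Set.Icc 0 T) := by
    have := intervalIntegral.continuousOn_primitive_interval (μ := MeasureTheory.volume)
      (a := 0) (b := T) (f := D) (by
        rw [Set.uIcc_of_le hT]
        exact hD.integrableOn_Icc)
    rw [Set.uIcc_of_le hT] at this
    fun_prop
  have hanti := antitoneOn_of_deriv_nonpos (convex_Icc 0 T) hcont
    (fun s hs => by
      rw [interior_Icc] at hs
      exact (hder s hs).differentiableAt.differentiableWithinAt)
    (fun s hs => by
      rw [interior_Icc] at hs
      rw [(hder s hs).deriv]
      refine mul_nonpos_of_nonpos_of_nonneg ?_ (Real.exp_pos _).le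
      have := mul_le_mul_of_nonneg_left (h s (Set.Ioo_subset_Icc_self hs)) hK
      linarith)
  have := hanti (Set.left_mem_Icc.2 hT) ht ht.1
  simp only [intervalIntegral.integral_same, mul_zero, add_zero, Real.exp_zero, mul_one,
    neg_mul, Real.exp_neg] at this
  rw [← div_eq_mul_inv, div_le_iff₀ (Real.exp_pos _)] at this
  exact (h t ht).trans this

/-- Averaging by freezing the slow variable on intervals of length `δ`. -/
theorem abs_integral_diag_le {φ : ℝ → ℝ → ℝ} {T δ N ω : ℝ} (hδ : 0 < δ)
    (hω : 0 ≤ ω) (hN0 : 0 ≤ N)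
    (hdiag : ContinuousOn (fun s => φ s s) (Set.Icc 0 T))
    (hφ : ∀ s ∈ Set.Icc 0 T, Continuous (φ s))
    (hosc : ∀ s ∈ Set.Icc 0 T, ∀ s' ∈ Set.Icc 0 T, |s - s'| ≤ δ → ∀ τ, |φ s τ - φ s' τ| ≤ ω)
    (hN : ∀ s ∈ Set.Icc 0 T, ∀ u v, 0 ≤ u → u ≤ v → |∫ τ in u..v, φ s τ| ≤ N) :
    ∀ t ∈ Set.Icc 0 T, |∫ s in (0:ℝ)..t, φ s s| ≤ (T / δ + 1) * N + ω * T := by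
  have hint : ∀ u ∈ Set.Icc 0 T, ∀ v ∈ Set.Icc 0 T,
      IntervalIntegrable (fun s => φ s s) MeasureTheory.volume u v := fun u hu v hv =>
    (hdiag.mono (Set.uIcc_subset_Icc hu hv)).intervalIntegrable
  have hshort : ∀ u ∈ Set.Icc 0 T, ∀ v ∈ Set.Icc 0 T, u ≤ v → v - u ≤ δ →
      |∫ s in u..v, φ s s| ≤ N + ω * (v - u) := by
    intro u hu v hv huv hvu
    have hsub := intervalIntegral.integral_sub (hint u hu v hv)
      ((hφ u hu).intervalIntegrable (μ := MeasureTheory.volume) u v)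
    have h1 := intervalIntegral.norm_integral_le_of_norm_le_const
      (a := u) (b := v) (f := fun s => φ s s - φ u s) (C := ω) (fun s hs => by
        rw [Set.uIoc_of_le huv] at hs
        exact hosc s ⟨hu.1.trans hs.1.le, hs.2.trans hv.2⟩ u hu
          (by rw [abs_of_nonneg (by linarith [hs.1])]; linarith [hs.2]) s)
    rw [hsub, abs_of_nonneg (sub_nonneg.2 huv), Real.norm_eq_abs] at h1
    have h2 := hN u hu u v hu.1 huv
    have h3 := abs_sub_abs_le_abs_sub (∫ s in u..v, φ s s) (∫ s in u..v, φ u s)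
    linarith
  have hind : ∀ n : ℕ, ∀ t ∈ Set.Icc 0 T, t ≤ n * δ →
      |∫ s in (0:ℝ)..t, φ s s| ≤ n * N + ω * t := by
    intro n
    induction n with
    | zero =>
      intro t ht htn
      have : t = 0 := le_antisymm (by simpa using htn) ht.1
      simp [this]
    | succ n ih =>
      intro t ht htn
      push_cast at htn ⊢
      have h0 : (0:ℝ) ∈ Set.Icc 0 T := ⟨le_rfl, ht.1.trans ht.2⟩
      have hu : max 0 (t - δ) ∈ Set.Icc 0 T :=
        ⟨le_max_left _ _, max_le h0.2 (by linarith [ht.2])⟩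
      have hut : max 0 (t - δ) ≤ t := max_le ht.1 (by linarith)
      have h1 := ih _ hu (max_le (by positivity) (by linarith))
      have h2 := hshort _ hu t ht hut (by linarith [le_max_right 0 (t - δ)])
      have h3 := intervalIntegral.integral_add_adjacent_intervals
        (hint 0 h0 _ hu) (hint _ hu t ht)
      have h4 := abs_add_le (∫ s in (0:ℝ)..(max 0 (t - δ)), φ s s)
        (∫ s in (max 0 (t - δ))..t, φ s s)
      rw [h3] at h4
      linarith
  intro t ht
  have hT : 0 ≤ T := ht.1.trans ht.2
  have h1 : t ≤ ⌈T / δ⌉₊ * δ := ht.2.trans ((div_le_iff₀ hδ).1 (Nat.le_ceil _))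
  have h2 : (⌈T / δ⌉₊ : ℝ) ≤ T / δ + 1 := (Nat.ceil_lt_add_one (by positivity)).le
  refine (hind _ t ht h1).trans ?_
  gcongr
  exact ht.2

theorem abs_timeAverage_limit_le {f : ℝ → ℝ} {C l : ℝ} (hf : ∀ s, |f s| ≤ C)
    (hl : Filter.Tendsto (fun t : ℝ => (1 / t) * ∫ s in (0:ℝ)..t, f s) Filter.atTop (nhds l)) :
    |l| ≤ C := by
  refine le_of_tendsto hl.abs ((Filter.eventually_gt_atTop 0).mono fun t ht => ?_)
  have := intervalIntegral.norm_integral_le_of_norm_le_const (a := 0) (b := t) (f := f)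
    (fun s _ => hf s)
  rw [sub_zero, abs_of_pos ht, Real.norm_eq_abs] at this
  rw [abs_mul, abs_of_pos (by positivity), one_div, inv_mul_le_iff₀ ht]
  linarith

theorem abs_mul_sub_mul_le {a a' β β' A B d e : ℝ} (ha : |a'| ≤ A) (hβ : |β| ≤ B)
    (hd : |a - a'| ≤ d) (he : |β - β'| ≤ e) : |a * β - a' * β'| ≤ d * B + A * e := by
  have hd0 := (abs_nonneg _).trans hd
  have hA0 := (abs_nonneg _).trans ha
  calc |a * β - a' * β'| = |(a - a') * β + a' * (β - β')| := by ring_nf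
    _ ≤ |a - a'| * |β| + |a'| * |β - β'| := (abs_add_le _ _).trans_eq (by rw [abs_mul, abs_mul])
    _ ≤ d * B + A * e := by gcongr

/-- Solutions stay in a fixed ball and are Lipschitz in time. -/
theorem SolvesAveragingODE.bounds {F H b : ℝ × ℝ → ℝ} {m : ℝ → ℝ} {T x₀ ε : ℝ} {Y : ℝ → ℝ}
    (hY : SolvesAveragingODE F H b m T x₀ ε Y) {a : ℝ → ℝ → ℝ}
    (ha : ∀ r y, deriv (fun z : ℝ => H (r, z)) (F (r, y)) = a r y) {A B : ℝ}
    (haA : ∀ t ∈ Set.Icc 0 T, ∀ y, |a (m t) y| ≤ A) (hB : ∀ p, |b p| ≤ B) :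
    ∀ t ∈ Set.Icc 0 T, |Y t| ≤ |H (0, x₀)| + A * B * T := by
  intro t ht
  have hAB : ∀ s ∈ Set.uIoc 0 t,
      ‖deriv (fun y : ℝ => H (m s, y)) (F (m s, Y s)) * b (F (m s, Y s), s / ε)‖ ≤ A * B := by
    intro s hs
    rw [Set.uIoc_of_le ht.1] at hs
    have h := haA s ⟨hs.1.le, hs.2.trans ht.2⟩ (Y s)
    rw [ha, Real.norm_eq_abs, abs_mul]
    exact mul_le_mul h (hB _) (abs_nonneg _) ((abs_nonneg _).trans h)
  have h := intervalIntegral.norm_integral_le_of_norm_le_const hAB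
  have hA := (abs_nonneg _).trans (haA t ht 0)
  have hB0 := (abs_nonneg _).trans (hB 0)
  rw [sub_zero, abs_of_nonneg ht.1] at h
  rw [hY.2 t ht]
  refine (abs_add_le _ _).trans (add_le_add le_rfl (h.trans ?_))
  exact mul_le_mul_of_nonneg_left ht.2 (mul_nonneg hA hB0)

/-- If in addition `m` is `γ`-Hölder continuous for some `γ ∈ (0, 1]`,
i.e. `|m t − m s| ≤ Λ |t − s|^γ` on `[0, T]`, then there is a constant `K` (depending only
on `σ`, `b`, `T`, `m`, `Λ`, `γ` and `x₀`) such that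
`sup_{t ∈ [0,T]} |X^ε t − X̄ t| ≤ K ε^{γ/(1+γ)}` for all `ε ∈ (0, 1]`. -/
theorem averaging_rate_holder
    (σ : ℝ → ℝ) (hσ : ContDiff ℝ 2 σ)
    (C₁ : ℝ) (hC₁ : ∀ x, |deriv σ x| ≤ C₁)
    (C₂ : ℝ) (hC₂ : ∀ x, |deriv (deriv σ) x| ≤ C₂)
    (F H : ℝ × ℝ → ℝ)
    (hF0 : ∀ x : ℝ, F (0, x) = x)
    (hFr : ∀ r x : ℝ, HasDerivAt (fun r' : ℝ => F (r', x)) (σ (F (r, x))) r)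
    (hH : ∀ r : ℝ, Function.LeftInverse (fun y : ℝ => H (r, y)) (fun x : ℝ => F (r, x)) ∧
      Function.RightInverse (fun y : ℝ => H (r, y)) (fun x : ℝ => F (r, x)))
    (b : ℝ × ℝ → ℝ) (hbc : Continuous b)
    (B : ℝ) (hB : ∀ p, |b p| ≤ B)
    (L : ℝ → ℝ)
    (hbL : ∀ c : ℝ, 0 < c → ∀ x y t : ℝ, |x| ≤ c → |y| ≤ c →
      |b (x, t) - b (y, t)| ≤ L c * |x - y|)
    (T : ℝ) (hT : 0 < T)
    (m : ℝ → ℝ) (hm : ContinuousOn m (Set.Icc 0 T)) (hm0 : m 0 = 0)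
    (x₀ : ℝ)
    (bbar : ℝ → ℝ)
    (hbar : ∀ y : ℝ, Filter.Tendsto (fun t : ℝ => (1 / t) * ∫ s in (0:ℝ)..t, b (y, s))
      Filter.atTop (nhds (bbar y)))
    (M : ℝ)
    (hG : ∀ y : ℝ, ∀ r : ℝ, 0 ≤ r → |∫ s in (0:ℝ)..r, (b (y, s) - bbar y)| ≤ M)
    (γ Λ : ℝ) (hγ0 : 0 < γ) (hγ1 : γ ≤ 1)
    (hHol : ∀ s ∈ Set.Icc (0:ℝ) T, ∀ t ∈ Set.Icc (0:ℝ) T, |m t - m s| ≤ Λ * |t - s| ^ γ) :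
    ∃ K : ℝ, ∀ ε : ℝ, 0 < ε → ε ≤ 1 →
      ∀ Y Ybar : ℝ → ℝ, SolvesAveragingODE F H b m T x₀ ε Y →
        SolvesAveragingODE F H (fun p : ℝ × ℝ => bbar p.1) m T x₀ 1 Ybar →
        ∀ t ∈ Set.Icc (0:ℝ) T,
          |F (m t, Y t) - F (m t, Ybar t)| ≤ K * ε ^ (γ / (1 + γ)) := by
  have hB0 : 0 ≤ B := (abs_nonneg _).trans (hB 0)
  have hM0 : 0 ≤ M := (abs_nonneg _).trans (hG 0 0 le_rfl)
  have hC₁0 : 0 ≤ C₁ := (abs_nonneg _).trans (hC₁ 0)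
  have h0T : (0:ℝ) ∈ Set.Icc 0 T := ⟨le_rfl, hT.le⟩
  obtain ⟨R, hR⟩ := isCompact_Icc.exists_bound_of_continuousOn hm
  simp only [Real.norm_eq_abs] at hR
  have hR0 : 0 ≤ R := (abs_nonneg _).trans (hR 0 h0T)
  set a : ℝ → ℝ → ℝ := fun r y => Real.exp (-∫ u in (0:ℝ)..r, deriv σ (F (u, y))) with ha_def
  have ha : ∀ r y, deriv (fun z : ℝ => H (r, z)) (F (r, y)) = a r y :=
    deriv_inverse_flow hσ hC₁ hC₂ hF0 hFr hH
  obtain ⟨A, hA0, haA⟩ : ∃ A, 0 ≤ A ∧ ∀ t ∈ Set.Icc 0 T, ∀ y, |a (m t) y| ≤ A := by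
    refine ⟨Real.exp (C₁ * R), (Real.exp_pos _).le, fun t ht y => ?_⟩
    have h := intervalIntegral.norm_integral_le_of_norm_le_const
      (a := 0) (b := m t) (f := fun u => deriv σ (F (u, y))) (fun u _ => hC₁ _)
    rw [sub_zero, Real.norm_eq_abs] at h
    have h2 := mul_le_mul_of_nonneg_left (hR t ht) hC₁0
    rw [ha_def, abs_of_pos (Real.exp_pos _)]
    exact Real.exp_le_exp.2 ((neg_le_abs _).trans (h.trans h2))
  set ρ := |H (0, x₀)| + A * B * T
  obtain ⟨c, K, hc, hK, hFc, hFK⟩ := exists_flow_local_bounds hσ hC₁ hC₂ hF0 hFr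
    (a := a) (fun _ _ => rfl) hR0 (ρ := ρ) (by positivity)
  have hLip := abs_image_sub_le_of_abs_deriv_le (hσ.differentiable (by norm_num)) hC₁
  have hbbarB : ∀ y, |bbar y| ≤ B := fun y => abs_timeAverage_limit_le (fun s => hB (y, s)) (hbar y)
  have hbs : ∀ y, Continuous fun s => b (y, s) := fun y => hbc.comp (by fun_prop)
  have hb_lip : ∀ x y t : ℝ, |x| ≤ c → |y| ≤ c → |b (x, t) - b (y, t)| ≤ |L c| * |x - y| :=
    fun x y t hx hy => (hbL c hc x y t hx hy).trans
      (mul_le_mul_of_nonneg_right (le_abs_self _) (abs_nonneg _))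
  have hbbar_lip : ∀ x y : ℝ, |x| ≤ c → |y| ≤ c → |bbar x - bbar y| ≤ |L c| * |x - y| := by
    intro x y hx hy
    refine abs_timeAverage_limit_le (f := fun s => b (x, s) - b (y, s))
      (fun s => hb_lip x y s hx hy) (((hbar x).sub (hbar y)).congr fun t => ?_)
    rw [intervalIntegral.integral_sub ((hbs x).intervalIntegrable _ _)
      ((hbs y).intervalIntegrable _ _), mul_sub]
  set K' := K * (2 * B) + A * (2 * |L c| * K)
  have hK'0 : 0 ≤ K' := by positivity
  set N₀ := 2 * A * M * (T + 1) + K' * (|Λ| + A * B) * T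
  have hN₀0 : 0 ≤ N₀ := by positivity
  refine ⟨Real.exp (C₁ * R) * (N₀ * Real.exp (K' * T)), ?_⟩
  intro ε hε hε1 Y Ybar hY hYbar
  have hYρ := hY.bounds ha haA hB
  have hYbarρ := hYbar.bounds ha haA (fun p => hbbarB p.1)
  have hFY : ∀ Z : ℝ → ℝ, ContinuousOn Z (Set.Icc 0 T) → (∀ t ∈ Set.Icc 0 T, |Z t| ≤ ρ) →
      ContinuousOn (fun s => F (m s, Z s)) (Set.Icc 0 T) ∧
      ContinuousOn (fun s => a (m s) (Z s)) (Set.Icc 0 T) := fun Z hZ hZρ =>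
    ⟨continuousOn_of_abs_sub_le hm hZ fun t ht u hu =>
      (hFK _ _ _ _ (hR t ht) (hR u hu) (hZρ t ht) (hZρ u hu)).1,
    continuousOn_of_abs_sub_le hm hZ fun t ht u hu =>
      (hFK _ _ _ _ (hR t ht) (hR u hu) (hZρ t ht) (hZρ u hu)).2⟩
  have hbbarc : ContinuousOn bbar (Set.Icc (-c) c) :=
    (LipschitzOnWith.of_dist_le_mul (K := ⟨|L c|, abs_nonneg _⟩) fun x hx y hy =>
      hbbar_lip x y (abs_le.2 hx) (abs_le.2 hy)).continuousOn
  have hbbarZ : ∀ Z : ℝ → ℝ, ContinuousOn Z (Set.Icc 0 T) → (∀ t ∈ Set.Icc 0 T, |Z t| ≤ ρ) →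
      ContinuousOn (fun s => a (m s) (Z s) * bbar (F (m s, Z s))) (Set.Icc 0 T) :=
    fun Z hZ hZρ => (hFY Z hZ hZρ).2.mul (hbbarc.comp (hFY Z hZ hZρ).1 fun t ht =>
      abs_le.1 (hFc _ _ (hR t ht) (hZρ t ht)))
  have hYc : ContinuousOn (fun s => a (m s) (Y s) * b (F (m s, Y s), s / ε)) (Set.Icc 0 T) :=
    (hFY Y hY.1 hYρ).2.mul (hbc.comp_continuousOn
      ((hFY Y hY.1 hYρ).1.prodMk (by fun_prop)))
  have hint : ∀ {f : ℝ → ℝ}, ContinuousOn f (Set.Icc 0 T) → ∀ u ∈ Set.Icc 0 T,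
      ∀ v ∈ Set.Icc 0 T, IntervalIntegrable f MeasureTheory.volume u v := fun hf u hu v hv =>
    (hf.mono (Set.uIcc_subset_Icc hu hv)).intervalIntegrable
  have hYeq : ∀ t ∈ Set.Icc 0 T, Y t = H (0, x₀) +
      ∫ s in (0:ℝ)..t, a (m s) (Y s) * b (F (m s, Y s), s / ε) := fun t ht => by
    rw [hY.2 t ht]; simp only [ha]
  have hYbareq : ∀ t ∈ Set.Icc 0 T, Ybar t = H (0, x₀) +
      ∫ s in (0:ℝ)..t, a (m s) (Ybar s) * bbar (F (m s, Ybar s)) := fun t ht => by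
    rw [hYbar.2 t ht]; simp only [ha]
  have hYlip : ∀ s ∈ Set.Icc 0 T, ∀ t ∈ Set.Icc 0 T, |Y s - Y t| ≤ A * B * |s - t| := by
    intro s hs t ht
    rw [hYeq s hs, hYeq t ht, add_sub_add_left_eq_sub,
      intervalIntegral.integral_interval_sub_left (hint hYc 0 h0T s hs) (hint hYc 0 h0T t ht)]
    refine intervalIntegral.norm_integral_le_of_norm_le_const
      (f := fun s => a (m s) (Y s) * b (F (m s, Y s), s / ε)) fun u hu => ?_
    rw [Real.norm_eq_abs, abs_mul]
    exact mul_le_mul (haA u (Set.uIcc_subset_Icc ht hs (Set.uIoc_subset_uIcc hu)) _) (hB _)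
      (abs_nonneg _) hA0
  set φ : ℝ → ℝ → ℝ := fun s τ =>
    a (m s) (Y s) * (b (F (m s, Y s), τ / ε) - bbar (F (m s, Y s))) with hφ_def
  set δ := ε ^ (1 / (1 + γ))
  set η := ε ^ (γ / (1 + γ))
  have hδ0 : 0 < δ := Real.rpow_pos_of_pos hε _
  have hη0 : 0 < η := Real.rpow_pos_of_pos hε _
  have hδ1 : δ ≤ 1 := Real.rpow_le_one hε.le hε1 (by positivity)
  have hδη : δ ^ γ = η := by
    rw [← Real.rpow_mul hε.le]
    congr 1
    ring
  have hδη' : δ ≤ η := by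
    rw [← hδη]
    simpa using Real.rpow_le_rpow_of_exponent_ge hδ0 hδ1 hγ1
  have hεη : ε = η * δ := by
    rw [← Real.rpow_add hε, ← add_div, add_comm γ 1, div_self (by positivity), Real.rpow_one]
  have hφdiag : ContinuousOn (fun s => φ s s) (Set.Icc 0 T) :=
    (hYc.sub (hbbarZ Y hY.1 hYρ)).congr fun s _ => mul_sub _ _ _
  have hφint : ∀ s ∈ Set.Icc 0 T, ∀ u v, 0 ≤ u → u ≤ v → |∫ τ in u..v, φ s τ| ≤ 2 * A * M * ε := by
    intro s hs u v hu huv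
    set x := F (m s, Y s)
    have hcont : Continuous fun τ => b (x, τ) - bbar x := (hbs x).sub continuous_const
    have h1 : ∫ τ in u..v, φ s τ =
        a (m s) (Y s) * (ε * ((∫ τ in (0:ℝ)..(v / ε), (b (x, τ) - bbar x)) -
          ∫ τ in (0:ℝ)..(u / ε), (b (x, τ) - bbar x))) := by
      rw [intervalIntegral.integral_interval_sub_left (hcont.intervalIntegrable _ _)
        (hcont.intervalIntegrable _ _), ← smul_eq_mul ε,
        ← intervalIntegral.integral_comp_div (fun τ => b (x, τ) - bbar x) hε.ne',
        ← intervalIntegral.integral_const_mul]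
    have h2 := (abs_sub _ _).trans (add_le_add (hG x (v / ε) (by have := hu.trans huv; positivity))
      (hG x (u / ε) (by positivity)))
    rw [h1, abs_mul, abs_mul, abs_of_pos hε]
    calc _ ≤ A * (ε * (M + M)) :=
          mul_le_mul (haA s hs _) (mul_le_mul_of_nonneg_left h2 hε.le) (by positivity) hA0
      _ = _ := by ring
  have hφosc : ∀ s ∈ Set.Icc 0 T, ∀ s' ∈ Set.Icc 0 T, |s - s'| ≤ δ → ∀ τ,
      |φ s τ - φ s' τ| ≤ K' * (|Λ| + A * B) * η := by
    intro s hs s' hs' hss τ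
    obtain ⟨h1, h2⟩ := hFK _ _ _ _ (hR s hs) (hR s' hs') (hYρ s hs) (hYρ s' hs')
    have hFs := hFc _ _ (hR s hs) (hYρ s hs)
    have hFs' := hFc _ _ (hR s' hs') (hYρ s' hs')
    set D := |m s - m s'| + |Y s - Y s'|
    have hD : D ≤ (|Λ| + A * B) * η := by
      have h3 : |m s - m s'| ≤ |Λ| * η := by
        refine (hHol s' hs' s hs).trans (mul_le_mul (le_abs_self _) ?_ (by positivity)
          (abs_nonneg _))
        rw [← hδη]
        exact Real.rpow_le_rpow (abs_nonneg _) hss hγ0.le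
      have h4 : |Y s - Y s'| ≤ A * B * η :=
        (hYlip s hs s' hs').trans (mul_le_mul_of_nonneg_left (hss.trans hδη') (by positivity))
      linarith
    have h5 : |(b (F (m s, Y s), τ / ε) - bbar (F (m s, Y s))) -
        (b (F (m s', Y s'), τ / ε) - bbar (F (m s', Y s')))| ≤ 2 * |L c| * (K * D) := by
      rw [sub_sub_sub_comm]
      have h6 := (abs_sub _ _).trans (add_le_add (hb_lip _ _ (τ / ε) hFs hFs')
        (hbbar_lip _ _ hFs hFs'))
      have h7 := mul_le_mul_of_nonneg_left h1 (abs_nonneg (L c))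
      linarith
    have h8 : |b (F (m s, Y s), τ / ε) - bbar (F (m s, Y s))| ≤ 2 * B :=
      (abs_sub _ _).trans ((add_le_add (hB _) (hbbarB _)).trans_eq (two_mul B).symm)
    calc _ ≤ K * D * (2 * B) + A * (2 * |L c| * (K * D)) :=
          abs_mul_sub_mul_le (haA s' hs' _) h8 h2 h5
      _ = K' * D := by ring
      _ ≤ K' * ((|Λ| + A * B) * η) := mul_le_mul_of_nonneg_left hD hK'0
      _ = _ := by ring
  have havg : ∀ t ∈ Set.Icc 0 T, |∫ s in (0:ℝ)..t, φ s s| ≤ N₀ * η := by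
    intro t ht
    refine (abs_integral_diag_le hδ0 (by positivity) (by positivity) hφdiag
      (fun s _ => ((hbc.comp (by fun_prop)).sub continuous_const).const_mul _)
      hφosc hφint t ht).trans ?_
    have h1 : (T / δ + 1) * ε ≤ (T + 1) * η := by
      rw [hεη]
      calc (T / δ + 1) * (η * δ) = T * η + η * δ := by field_simp
        _ ≤ T * η + η * 1 := by gcongr
        _ = (T + 1) * η := by ring
    calc _ = 2 * A * M * ((T / δ + 1) * ε) + K' * (|Λ| + A * B) * η * T := by ring
      _ ≤ 2 * A * M * ((T + 1) * η) + K' * (|Λ| + A * B) * η * T := by gcongr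
      _ = N₀ * η := by ring
  have hg_lip : ∀ s ∈ Set.Icc 0 T,
      |a (m s) (Y s) * bbar (F (m s, Y s)) - a (m s) (Ybar s) * bbar (F (m s, Ybar s))|
        ≤ K' * |Y s - Ybar s| := by
    intro s hs
    obtain ⟨h1, h2⟩ := hFK _ _ _ _ (hR s hs) (hR s hs) (hYρ s hs) (hYbarρ s hs)
    rw [sub_self, abs_zero, zero_add] at h1 h2
    have h3 := (hbbar_lip _ _ (hFc _ _ (hR s hs) (hYρ s hs))
      (hFc _ _ (hR s hs) (hYbarρ s hs))).trans (mul_le_mul_of_nonneg_left h1 (abs_nonneg (L c)))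
    refine (abs_mul_sub_mul_le (haA s hs _) (hbbarB _) h2 h3).trans ?_
    have h4 : 0 ≤ K * |Y s - Ybar s| * B := by positivity
    have h5 : 0 ≤ A * (|L c| * (K * |Y s - Ybar s|)) := by positivity
    have h6 : K' * |Y s - Ybar s| = 2 * (K * |Y s - Ybar s| * B) +
      2 * (A * (|L c| * (K * |Y s - Ybar s|))) := by ring
    linarith
  have hDc : ContinuousOn (fun s => |Y s - Ybar s|) (Set.Icc 0 T) := (hY.1.sub hYbar.1).abs
  have hgron := le_mul_exp_of_le_add_integral (η := N₀ * η) hK'0 hDc fun t ht => by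
    have hI1 := hint hφdiag 0 h0T t ht
    have hI2 : IntervalIntegrable (fun s => a (m s) (Y s) * bbar (F (m s, Y s)) -
        a (m s) (Ybar s) * bbar (F (m s, Ybar s))) MeasureTheory.volume 0 t :=
      hint ((hbbarZ Y hY.1 hYρ).sub (hbbarZ Ybar hYbar.1 hYbarρ)) 0 h0T t ht
    have hsplit : Y t - Ybar t = (∫ s in (0:ℝ)..t, φ s s) +
        ∫ s in (0:ℝ)..t, (a (m s) (Y s) * bbar (F (m s, Y s)) -
          a (m s) (Ybar s) * bbar (F (m s, Ybar s))) := by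
      rw [hYeq t ht, hYbareq t ht, add_sub_add_left_eq_sub,
        ← intervalIntegral.integral_sub (hint hYc 0 h0T t ht)
          (hint (hbbarZ Ybar hYbar.1 hYbarρ) 0 h0T t ht),
        ← intervalIntegral.integral_add hI1 hI2]
      refine intervalIntegral.integral_congr fun s _ => ?_
      simp only [hφ_def]
      ring
    rw [hsplit, ← intervalIntegral.integral_const_mul]
    refine (abs_add_le _ _).trans (add_le_add (havg t ht) ?_)
    exact intervalIntegral.norm_integral_le_of_norm_le ht.1
      (f := fun s => a (m s) (Y s) * bbar (F (m s, Y s)) -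
        a (m s) (Ybar s) * bbar (F (m s, Ybar s)))
      (Filter.Eventually.of_forall fun s hs => hg_lip s ⟨hs.1.le, hs.2.trans ht.2⟩)
      ((hint hDc 0 h0T t ht).const_mul K')
  intro t ht
  have hflow := abs_trajectory_sub_le hLip (hFr · (Y t)) (hFr · (Ybar t)) (m t) 0
  simp only [hF0, sub_zero] at hflow
  calc _ ≤ Real.exp (C₁ * |m t|) * |Y t - Ybar t| := hflow
    _ ≤ Real.exp (C₁ * R) * (N₀ * η * Real.exp (K' * T)) := by
      refine mul_le_mul (Real.exp_le_exp.2 (mul_le_mul_of_nonneg_left (hR t ht) hC₁0))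
        ((hgron t ht).trans ?_) (abs_nonneg _) (Real.exp_pos _).le
      refine mul_le_mul_of_nonneg_left (Real.exp_le_exp.2 ?_) (by positivity)
      exact mul_le_mul_of_nonneg_left ht.2 hK'0
    _ = _ := by ring
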